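/- arXiv:2512.02784 — 2 statements merged into one kernel-verified Lean document; each statement's English description precedes it below -/
import Mathlib

section
/- (Ornstein's non-inequality) Let d, m ≥ 2 and let T : M_{m,d}(ℝ) → ℝ^k be a linear map whose kernel contains a nonzero matrix of rank at most 2. Then there is no constant C such that ∫_{ℝ^d} ‖∇u(x)‖ dx ≤ C ∫_{ℝ^d} |T(∇u(x))| dx holds for all u ∈ C_c^∞(ℝ^d, ℝ^m); that is, for every C > 0 there exists u ∈ C_c^∞(ℝ^d, ℝ^m) with ‖∇u‖_{L¹(ℝ^d)} > C ‖T(∇u)‖_{L¹(ℝ^d)}. -/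
open MeasureTheory

noncomputable section

/-- `m × d` real matrices with the Frobenius norm, modelled as
`EuclideanSpace ℝ (Fin m × Fin d)`. -/
abbrev MatR (m d : ℕ) := EuclideanSpace ℝ (Fin m × Fin d)

/-- View an element of `MatR m d` as a genuine matrix. -/
def matOfR {m d : ℕ} (v : MatR m d) : Matrix (Fin m) (Fin d) ℝ :=
  Matrix.of fun i j => v (i, j)

/-- The Jacobian matrix of `u : ℝ^d → ℝ^m` at `x`, `(∇u)_{ij} = ∂u_i/∂x_j`. -/
def gradR {m d : ℕ} (u : EuclideanSpace ℝ (Fin d) → EuclideanSpace ℝ (Fin m))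
    (x : EuclideanSpace ℝ (Fin d)) : MatR m d :=
  (WithLp.equiv 2 _).symm fun p => fderiv ℝ u x (EuclideanSpace.single p.2 1) p.1

section OrnsteinNonInequality

open Filter Topology Real

/-- The linear map turning a derivative into the matrix of its partial derivatives. -/
def jacobianL (m d : ℕ) :
    (EuclideanSpace ℝ (Fin d) →L[ℝ] EuclideanSpace ℝ (Fin m)) →L[ℝ] MatR m d :=
  LinearMap.toContinuousLinearMap
    { toFun := fun A => (WithLp.equiv 2 _).symm fun p => A (EuclideanSpace.single p.2 1) p.1
      map_add' := fun _ _ => rfl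
      map_smul' := fun _ _ => rfl }

lemma gradR_eq_jacobianL {m d : ℕ} (u : EuclideanSpace ℝ (Fin d) → EuclideanSpace ℝ (Fin m))
    (x : EuclideanSpace ℝ (Fin d)) : gradR u x = jacobianL m d (fderiv ℝ u x) := rfl

/-- The rank-one matrix `a ⊗ L`, the Jacobian of `x ↦ L x • a`. -/
def rankOne {m d : ℕ} (a : EuclideanSpace ℝ (Fin m)) :
    (EuclideanSpace ℝ (Fin d) →L[ℝ] ℝ) →L[ℝ] MatR m d :=
  jacobianL m d ∘L (ContinuousLinearMap.smulRightL ℝ _ _).flip a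

lemma rankOne_apply {m d : ℕ} (a : EuclideanSpace ℝ (Fin m))
    (L : EuclideanSpace ℝ (Fin d) →L[ℝ] ℝ) (p : Fin m × Fin d) :
    rankOne a L p = L (EuclideanSpace.single p.2 1) * a p.1 := rfl

section Gradient

variable {m d : ℕ} {u : EuclideanSpace ℝ (Fin d) → EuclideanSpace ℝ (Fin m)}

lemma contDiff_gradR (hu : ContDiff ℝ (⊤ : ℕ∞) u) : ContDiff ℝ (⊤ : ℕ∞) (gradR u) :=
  (jacobianL m d).contDiff.comp (hu.fderiv_right (by simp))

lemma hasCompactSupport_gradR (hu : HasCompactSupport u) : HasCompactSupport (gradR u) :=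
  (hu.fderiv ℝ).comp_left (map_zero (jacobianL m d))

lemma gradR_add_smul (hu : Differentiable ℝ u) {ψ : EuclideanSpace ℝ (Fin d) → ℝ}
    (a : EuclideanSpace ℝ (Fin m)) {x : EuclideanSpace ℝ (Fin d)}
    {ψ' : EuclideanSpace ℝ (Fin d) →L[ℝ] ℝ} (hψ : HasFDerivAt ψ ψ' x) :
    gradR (fun y => u y + ψ y • a) x = gradR u x + rankOne a ψ' := by
  rw [gradR_eq_jacobianL, ((hu x).hasFDerivAt.fun_add (hψ.smul_const a)).fderiv, map_add]
  rfl

end Gradient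

/-- A smooth approximation (for `r` close to `1`) of the triangle wave. -/
def triangleWave (r τ : ℝ) : ℝ := arcsin (r * sin τ)

/-- The derivative of `triangleWave r`, which approximates a square wave. -/
def squareWave (r τ : ℝ) : ℝ := r * cos τ / √(1 - (r * sin τ) ^ 2)

section Waves

variable {r : ℝ}

lemma sq_mul_sin_lt_one (h0 : 0 ≤ r) (h1 : r < 1) (τ : ℝ) : (r * sin τ) ^ 2 < 1 := by
  have := sin_sq_le_one τ
  rw [mul_pow]
  nlinarith [sq_nonneg (sin τ)]

lemma contDiff_triangleWave (h0 : 0 ≤ r) (h1 : r < 1) :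
    ContDiff ℝ (⊤ : ℕ∞) (triangleWave r) := by
  refine contDiff_iff_contDiffAt.2 fun τ => ?_
  have h := sq_mul_sin_lt_one h0 h1 τ
  refine (contDiffAt_arcsin (x := r * sin τ) ?_ ?_).comp τ
    (contDiff_const.mul contDiff_sin).contDiffAt <;>
  · intro h'
    rw [h'] at h
    norm_num at h

lemma hasDerivAt_triangleWave (h0 : 0 ≤ r) (h1 : r < 1) (τ : ℝ) :
    HasDerivAt (triangleWave r) (squareWave r τ) τ := by
  have h := sq_mul_sin_lt_one h0 h1 τ
  have h2 : HasDerivAt arcsin (1 / √(1 - (r * sin τ) ^ 2)) (r * sin τ) := by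
    refine hasDerivAt_arcsin ?_ ?_ <;>
    · intro h'
      rw [h'] at h
      norm_num at h
  have := h2.comp τ ((hasDerivAt_sin τ).const_mul r)
  refine this.congr_deriv ?_
  simp only [squareWave]
  ring

lemma continuous_squareWave (h0 : 0 ≤ r) (h1 : r < 1) : Continuous (squareWave r) := by
  refine Continuous.div (by fun_prop) (by fun_prop) fun τ => ?_
  have h := sq_mul_sin_lt_one h0 h1 τ
  exact (sqrt_pos.2 (by linarith)).ne'

lemma triangleWave_periodic (r : ℝ) : Function.Periodic (triangleWave r) (2 * π) := fun τ => by
  simp [triangleWave]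

lemma squareWave_periodic (r : ℝ) : Function.Periodic (squareWave r) (2 * π) := fun τ => by
  simp [squareWave]

lemma abs_triangleWave_le (r τ : ℝ) : |triangleWave r τ| ≤ π / 2 :=
  abs_le.2 ⟨neg_pi_div_two_le_arcsin _, arcsin_le_pi_div_two _⟩

lemma abs_squareWave_le (h0 : 0 ≤ r) (h1 : r < 1) (τ : ℝ) : |squareWave r τ| ≤ 1 := by
  have h := sq_mul_sin_lt_one h0 h1 τ
  rw [squareWave, abs_div, abs_of_nonneg (sqrt_nonneg _), div_le_one (sqrt_pos.2 (by linarith))]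
  apply abs_le_sqrt
  have h2 := sin_sq_add_cos_sq τ
  have h3 : (r * cos τ) ^ 2 + (r * sin τ) ^ 2 = r ^ 2 := by linear_combination r ^ 2 * h2
  nlinarith

lemma tendsto_squareWave {r : ℕ → ℝ} (hr : Tendsto r atTop (𝓝 1)) {τ : ℝ} (hτ : cos τ ≠ 0) :
    Tendsto (fun j => squareWave (r j) τ) atTop (𝓝 (SignType.sign (cos τ) : ℝ)) := by
  have hc : 1 - (1 * sin τ) ^ 2 = cos τ ^ 2 := by rw [one_mul, cos_sq']
  have : (SignType.sign (cos τ) : ℝ) = 1 * cos τ / √(1 - (1 * sin τ) ^ 2) := by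
    rw [hc, sqrt_sq_eq_abs, eq_div_iff (abs_ne_zero.2 hτ), one_mul, sign_mul_abs]
  rw [this]
  refine Tendsto.div (hr.mul_const _) ?_ ?_
  · exact (continuous_sqrt.tendsto _).comp (((hr.mul_const _).pow 2).const_sub 1)
  · rw [hc, sqrt_sq_eq_abs]
    exact abs_ne_zero.2 hτ

end Waves

/-- If a family of periodic functions has nonnegative space average for every global phase shift
of a given modulation, then so does its average over the period. -/
lemma integral_period_nonneg_of_phase {d : ℕ} {W : EuclideanSpace ℝ (Fin d) → ℝ → ℝ} {T : ℝ}
    (hT : 0 ≤ T) (hW : Continuous (Function.uncurry W)) (hper : ∀ x, Function.Periodic (W x) T)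
    {K : Set (EuclideanSpace ℝ (Fin d))} (hK : IsCompact K) (hWK : ∀ x ∉ K, ∀ τ, W x τ = 0)
    {θ : EuclideanSpace ℝ (Fin d) → ℝ} (hθ : Continuous θ)
    (h : ∀ τ, 0 ≤ ∫ x, W x (θ x + τ)) (t : ℝ) :
    0 ≤ ∫ x, ∫ τ in t..t + T, W x τ := by
  have hshift (x) : ∫ τ in t..t + T, W x τ = ∫ τ in t..t + T, W x (θ x + τ) := by
    rw [intervalIntegral.integral_comp_add_left, ← add_assoc]
    exact (hper x).intervalIntegral_add_eq _ _
  have ht : t ≤ t + T := by linarith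
  simp_rw [hshift, intervalIntegral.integral_of_le ht]
  rw [integral_integral_swap]
  · exact integral_nonneg h
  · have : (volume : Measure (EuclideanSpace ℝ (Fin d))).prod
        ((volume : Measure ℝ).restrict (Set.Ioc t (t + T))) =
        (volume.prod volume).restrict (Set.univ ×ˢ Set.Ioc t (t + T)) := by
      rw [← Measure.prod_restrict, Measure.restrict_univ]
    rw [this]
    have hcont : Continuous (Function.uncurry fun x τ => W x (θ x + τ)) :=
      hW.comp (continuous_fst.prodMk ((hθ.comp continuous_fst).add continuous_snd))
    have hint : IntegrableOn (Function.uncurry fun x τ => W x (θ x + τ))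
        (K ×ˢ Set.Icc t (t + T)) (volume.prod volume) :=
      hcont.continuousOn.integrableOn_compact (hK.prod isCompact_Icc)
    refine hint.of_forall_sdiff_eq_zero (MeasurableSet.univ.prod measurableSet_Ioc) ?_
    rintro ⟨x, τ⟩ ⟨⟨-, hτ⟩, hx⟩
    refine hWK x (fun hxK => hx ⟨hxK, Set.Ioc_subset_Icc_self hτ⟩) _

/-- Integrals over a period of functions supported in a fixed compact set converge under
bounded pointwise convergence. -/
lemma tendsto_integral_period {d : ℕ} {W : ℕ → EuclideanSpace ℝ (Fin d) → ℝ → ℝ}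
    {W' : EuclideanSpace ℝ (Fin d) → ℝ → ℝ} {t s B : ℝ}
    (hW : ∀ j, Continuous (Function.uncurry (W j)))
    {K : Set (EuclideanSpace ℝ (Fin d))} (hK : IsCompact K)
    (hWK : ∀ j, ∀ x ∉ K, ∀ τ, W j x τ = 0) (hB : ∀ j x τ, ‖W j x τ‖ ≤ B)
    (hlim : ∀ x, ∀ᵐ τ, Tendsto (fun j => W j x τ) atTop (𝓝 (W' x τ))) :
    Tendsto (fun j => ∫ x, ∫ τ in t..s, W j x τ) atTop (𝓝 (∫ x, ∫ τ in t..s, W' x τ)) := by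
  refine tendsto_integral_of_dominated_convergence (K.indicator fun _ => B * |s - t|)
    (fun j => ?_) ?_ (fun j => .of_forall fun x => ?_) (.of_forall fun x => ?_)
  · exact (intervalIntegral.continuous_parametric_intervalIntegral_of_continuous' (hW j)
      t s).aestronglyMeasurable
  · exact (integrable_indicator_iff hK.measurableSet).2 (integrableOn_const hK.measure_lt_top.ne)
  · by_cases hx : x ∈ K
    · rw [Set.indicator_of_mem hx]
      exact intervalIntegral.norm_integral_le_of_norm_le_const fun τ _ => hB j x τ
    · simp [hx, hWK j x hx]
  · refine intervalIntegral.tendsto_integral_filter_of_dominated_convergence (fun _ => B)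
      (.of_forall fun j => ?_) (.of_forall fun j => .of_forall fun τ _ => hB j x τ)
      intervalIntegrable_const ((hlim x).mono fun τ h _ => h)
    exact ((hW j).comp (Continuous.prodMk_right x)).aestronglyMeasurable

/-- The set of zeros of the cosine is negligible. -/
lemma ae_cos_ne_zero : ∀ᵐ τ : ℝ, cos τ ≠ 0 := by
  have : {τ : ℝ | cos τ = 0}.Countable := by
    refine (Set.countable_range fun k : ℤ => (2 * k + 1) * π / 2).mono fun τ hτ => ?_
    obtain ⟨k, hk⟩ := cos_eq_zero_iff.1 hτ
    exact ⟨k, hk.symm⟩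
  exact this.ae_notMem volume

/-- Averaging over a period of the square wave yields the average over the signs `±1`. -/
lemma integral_comp_sign_cos (f : ℝ → ℝ) :
    ∫ τ in (-(π / 2))..(-(π / 2) + 2 * π), f (SignType.sign (cos τ) : ℝ) =
      π * (f 1 + f (-1)) := by
  have hpi := pi_pos
  have h1 : Set.EqOn (fun τ => f (SignType.sign (cos τ) : ℝ)) (fun _ => f 1)
      (Set.Ioo (-(π / 2)) (π / 2)) := fun τ hτ => by
    simp [sign_pos (cos_pos_of_mem_Ioo hτ)]
  have h2 : Set.EqOn (fun τ => f (SignType.sign (cos τ) : ℝ)) (fun _ => f (-1))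
      (Set.Ioo (π / 2) (-(π / 2) + 2 * π)) := fun τ hτ => by
    simp [sign_neg (cos_neg_of_pi_div_two_lt_of_lt hτ.1 (by linarith [hτ.2]))]
  have hle1 : -(π / 2) ≤ π / 2 := by linarith
  have hle2 : π / 2 ≤ -(π / 2) + 2 * π := by linarith
  have key {a b c : ℝ} (hab : a ≤ b)
      (h : Set.EqOn (fun τ => f (SignType.sign (cos τ) : ℝ)) (fun _ => c) (Set.Ioo a b)) :
      IntervalIntegrable (fun τ => f (SignType.sign (cos τ) : ℝ)) volume a b ∧
        ∫ τ in a..b, f (SignType.sign (cos τ) : ℝ) = (b - a) * c := by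
    constructor
    · rw [intervalIntegrable_iff_integrableOn_Ioo_of_le hab]
      exact (integrableOn_const (by simp)).congr_fun h.symm measurableSet_Ioo
    · rw [intervalIntegral.integral_of_le hab, integral_Ioc_eq_integral_Ioo,
        setIntegral_congr_fun measurableSet_Ioo h]
      simp [hab]
  rw [← intervalIntegral.integral_add_adjacent_intervals (key hle1 h1).1 (key hle2 h2).1,
    (key hle1 h1).2, (key hle2 h2).2]
  ring

/-- An integrand vanishing at `0` whose integral along gradients of test functions is
nonnegative, i.e. which is quasiconvex at `0`. -/
structure QuasiconvexAtZero {m d : ℕ} (g : MatR m d → ℝ) : Prop where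
  continuous : Continuous g
  map_zero : g 0 = 0
  integral_nonneg : ∀ u : EuclideanSpace ℝ (Fin d) → EuclideanSpace ℝ (Fin m),
    ContDiff ℝ (⊤ : ℕ∞) u → HasCompactSupport u → 0 ≤ ∫ x, g (gradR u x)

namespace QuasiconvexAtZero

variable {m d : ℕ} {g : MatR m d → ℝ}

/-- Perturbing `u` by a highly oscillating simple laminate in the direction `a ⊗ L`. -/
lemma integral_oscillation_nonneg (hg : QuasiconvexAtZero g)
    {u : EuclideanSpace ℝ (Fin d) → EuclideanSpace ℝ (Fin m)}
    (hu : ContDiff ℝ (⊤ : ℕ∞) u) (hcu : HasCompactSupport u)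
    {φ : EuclideanSpace ℝ (Fin d) → ℝ} (hφ : ContDiff ℝ (⊤ : ℕ∞) φ) (hcφ : HasCompactSupport φ)
    (a : EuclideanSpace ℝ (Fin m)) (L : EuclideanSpace ℝ (Fin d) →L[ℝ] ℝ)
    {r : ℝ} (h0 : 0 ≤ r) (h1 : r < 1) {N : ℝ} (hN : N ≠ 0) (τ : ℝ) :
    0 ≤ ∫ x, g (gradR u x + (φ x * squareWave r (N * L x + τ)) • rankOne a L +
      (N⁻¹ * triangleWave r (N * L x + τ)) • rankOne a (fderiv ℝ φ x)) := by
  set ψ : EuclideanSpace ℝ (Fin d) → ℝ := fun x => N⁻¹ * (φ x * triangleWave r (N * L x + τ))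
    with hψ
  have hψs : ContDiff ℝ (⊤ : ℕ∞) ψ :=
    contDiff_const.mul (hφ.mul ((contDiff_triangleWave h0 h1).comp
      ((contDiff_const.mul L.contDiff).add contDiff_const)))
  have hψc : HasCompactSupport ψ := (hcφ.mul_right).mul_left
  have := hg.integral_nonneg (fun x => u x + ψ x • a) (hu.add (hψs.smul contDiff_const))
    (hcu.add hψc.smul_right)
  convert this using 4 with x
  have hd : HasFDerivAt ψ (N⁻¹ • (φ x • (squareWave r (N * L x + τ) • (N • L)) +
      triangleWave r (N * L x + τ) • fderiv ℝ φ x)) x := by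
    have hφd := (hφ.differentiable (by simp) x).hasFDerivAt
    have hin : HasFDerivAt (fun x => N * L x + τ) (N • L) x :=
      (L.hasFDerivAt.const_mul N).add_const τ
    exact (hφd.mul ((hasDerivAt_triangleWave h0 h1 _).comp_hasFDerivAt x hin)).const_mul N⁻¹
  rw [gradR_add_smul (hu.differentiable (by simp)) a hd, add_assoc]
  congr 1
  simp only [map_add, map_smul, smul_add, smul_smul]
  congr 2
  field_simp

/-- Splitting the gradient into two pieces along a rank-one direction, with an amplitude that
may vary in space. -/
lemma integral_split_nonneg (hg : QuasiconvexAtZero g)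
    {u : EuclideanSpace ℝ (Fin d) → EuclideanSpace ℝ (Fin m)}
    (hu : ContDiff ℝ (⊤ : ℕ∞) u) (hcu : HasCompactSupport u)
    {φ : EuclideanSpace ℝ (Fin d) → ℝ} (hφ : ContDiff ℝ (⊤ : ℕ∞) φ) (hcφ : HasCompactSupport φ)
    (a : EuclideanSpace ℝ (Fin m)) (L : EuclideanSpace ℝ (Fin d) →L[ℝ] ℝ) :
    0 ≤ ∫ x, (g (gradR u x + φ x • rankOne a L) + g (gradR u x - φ x • rankOne a L)) := by
  have hpi := pi_pos
  set S : EuclideanSpace ℝ (Fin d) → MatR m d := fun x => rankOne a (fderiv ℝ φ x) with hS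
  have hSc : Continuous S := (rankOne a).continuous.comp (hφ.continuous_fderiv (by simp))
  have hGc : Continuous (gradR u) := (contDiff_gradR hu).continuous
  have hGs := hasCompactSupport_gradR hcu
  have hSs : HasCompactSupport S := (hcφ.fderiv ℝ).comp_left (_root_.map_zero (rankOne a))
  obtain ⟨BG, hBG⟩ := hGs.exists_bound_of_continuous hGc
  obtain ⟨BS, hBS⟩ := hSs.exists_bound_of_continuous hSc
  obtain ⟨Bφ, hBφ⟩ := hcφ.exists_bound_of_continuous hφ.continuous
  obtain ⟨B, hB⟩ := (isCompact_closedBall (0 : MatR m d)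
    (BG + Bφ * ‖rankOne a L‖ + π / 2 * BS)).exists_bound_of_continuousOn hg.continuous.continuousOn
  set r : ℕ → ℝ := fun j => 1 - 1 / ((j : ℝ) + 1) with hr
  have hr0 (j) : 0 ≤ r j := by
    rw [hr, sub_nonneg, div_le_one (by positivity)]
    linarith [(Nat.cast_nonneg j : (0 : ℝ) ≤ j)]
  have hr1 (j) : r j < 1 := by
    have : 0 < 1 / ((j : ℝ) + 1) := by positivity
    simp only [hr]
    linarith
  have hrlim : Tendsto r atTop (𝓝 1) := by
    simpa [hr] using (tendsto_one_div_add_atTop_nhds_zero_nat (𝕜 := ℝ)).const_sub 1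
  set W : ℕ → EuclideanSpace ℝ (Fin d) → ℝ → ℝ := fun j x τ =>
    g (gradR u x + (φ x * squareWave (r j) τ) • rankOne a L +
      (((j : ℝ) + 1)⁻¹ * triangleWave (r j) τ) • S x) with hWdef
  have hW (j) : Continuous (Function.uncurry (W j)) := by
    have h1 := continuous_squareWave (hr0 j) (hr1 j)
    have h2 := (contDiff_triangleWave (hr0 j) (hr1 j)).continuous
    have h3 := hφ.continuous
    have h4 := hg.continuous
    simp only [hWdef, Function.uncurry_def]
    fun_prop
  set K := tsupport (gradR u) ∪ (tsupport φ ∪ tsupport S) with hK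
  have hKc : IsCompact K := hGs.isCompact.union (hcφ.isCompact.union hSs.isCompact)
  have hWK (j) : ∀ x ∉ K, ∀ τ, W j x τ = 0 := by
    intro x hx τ
    simp only [hK, Set.mem_union, not_or] at hx
    simp [hWdef, image_eq_zero_of_notMem_tsupport hx.1, image_eq_zero_of_notMem_tsupport hx.2.1,
      image_eq_zero_of_notMem_tsupport hx.2.2, hg.map_zero]
  have hWB (j x τ) : ‖W j x τ‖ ≤ B := by
    refine hB _ (mem_closedBall_zero_iff.2 ?_)
    refine norm_add₃_le.trans ?_
    gcongr ?_ + ?_ + ?_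
    · exact hBG x
    · rw [norm_smul, norm_mul]
      gcongr
      calc ‖φ x‖ * ‖squareWave (r j) τ‖ ≤ ‖φ x‖ * 1 := by
            gcongr
            exact abs_squareWave_le (hr0 j) (hr1 j) τ
        _ ≤ Bφ := by simpa using hBφ x
    · rw [norm_smul, norm_mul]
      have hj : ‖((j : ℝ) + 1)⁻¹‖ ≤ 1 := by
        rw [norm_of_nonneg (by positivity)]
        exact inv_le_one_of_one_le₀ (by linarith [(Nat.cast_nonneg j : (0 : ℝ) ≤ j)])
      calc _ ≤ 1 * (π / 2) * BS := by
            gcongr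
            · exact abs_triangleWave_le _ _
            · exact hBS x
        _ = _ := by ring
  have hlim (x) : ∀ᵐ τ, Tendsto (fun j => W j x τ) atTop
      (𝓝 (g (gradR u x + (φ x * (SignType.sign (cos τ) : ℝ)) • rankOne a L))) := by
    filter_upwards [ae_cos_ne_zero] with τ hτ
    refine (hg.continuous.tendsto _).comp ?_
    have htri : Tendsto (fun j : ℕ => ((j : ℝ) + 1)⁻¹ * triangleWave (r j) τ) atTop (𝓝 0) := by
      refine squeeze_zero_norm (a := fun j : ℕ => 1 / ((j : ℝ) + 1) * (π / 2)) (fun j => ?_) ?_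
      · rw [norm_mul, norm_of_nonneg (by positivity), one_div]
        gcongr
        exact abs_triangleWave_le _ _
      · simpa using (tendsto_one_div_add_atTop_nhds_zero_nat (𝕜 := ℝ)).mul_const (π / 2)
    simpa using (tendsto_const_nhds.add (((tendsto_squareWave hrlim hτ).const_mul (φ x)).smul_const
      (rankOne a L))).add (htri.smul_const (S x))
  have hnonneg (j : ℕ) : 0 ≤ ∫ x, ∫ τ in (-(π / 2))..(-(π / 2) + 2 * π), W j x τ := by
    refine integral_period_nonneg_of_phase (by positivity) (hW j) (fun x τ => ?_) hKc (hWK j)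
      (θ := fun x => ((j : ℝ) + 1) * L x) (by fun_prop) (fun τ => ?_) _
    · simp only [hWdef, squareWave_periodic (r j) τ, triangleWave_periodic (r j) τ]
    · exact hg.integral_oscillation_nonneg hu hcu hφ hcφ a L (hr0 j) (hr1 j) (by positivity) τ
  have key := ge_of_tendsto' (tendsto_integral_period hW hKc hWK hWB hlim) hnonneg
  have hinner (x) : ∫ τ in (-(π / 2))..(-(π / 2) + 2 * π),
      g (gradR u x + (φ x * (SignType.sign (cos τ) : ℝ)) • rankOne a L) =
        π * (g (gradR u x + (φ x * 1) • rankOne a L) +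
          g (gradR u x + (φ x * -1) • rankOne a L)) :=
    integral_comp_sign_cos fun σ => g (gradR u x + (φ x * σ) • rankOne a L)
  simp_rw [hinner] at key
  rw [integral_const_mul] at key
  simpa [sub_eq_add_neg] using nonneg_of_mul_nonneg_right key hpi

/-- Rank-one lamination with an amplitude depending on the gradient. -/
lemma split (hg : QuasiconvexAtZero g) {Φ : MatR m d → ℝ} (hΦ : ContDiff ℝ (⊤ : ℕ∞) Φ)
    (hΦ0 : Φ 0 = 0) (a : EuclideanSpace ℝ (Fin m)) (L : EuclideanSpace ℝ (Fin d) →L[ℝ] ℝ) :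
    QuasiconvexAtZero fun ξ =>
      (g (ξ + Φ ξ • rankOne a L) + g (ξ - Φ ξ • rankOne a L)) / 2 where
  continuous := by
    have h1 := hg.continuous
    have h2 := hΦ.continuous
    fun_prop
  map_zero := by simp [hΦ0, hg.map_zero]
  integral_nonneg u hu hcu := by
    rw [integral_div]
    exact div_nonneg (hg.integral_split_nonneg hu hcu (hΦ.comp (contDiff_gradR hu))
      ((hasCompactSupport_gradR hcu).comp_left hΦ0) a L) two_pos.le

/-- Rank-one convexity at zero. -/
lemma add_neg_rankOne_nonneg (hg : QuasiconvexAtZero g) (a : EuclideanSpace ℝ (Fin m))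
    (L : EuclideanSpace ℝ (Fin d) →L[ℝ] ℝ) : 0 ≤ g (rankOne a L) + g (-rankOne a L) := by
  let φ (j : ℕ) : ContDiffBump (0 : EuclideanSpace ℝ (Fin d)) :=
    { rIn := 1 - 1 / ((j : ℝ) + 2)
      rOut := 1
      rIn_pos := by
        rw [sub_pos, div_lt_one (by positivity)]
        linarith [(Nat.cast_nonneg j : (0 : ℝ) ≤ j)]
      rIn_lt_rOut := by
        have : 0 < 1 / ((j : ℝ) + 2) := by positivity
        linarith }
  set h : ℝ → ℝ := fun t => g (t • rankOne a L) + g (-(t • rankOne a L)) with hh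
  have hhc : Continuous h := by
    have := hg.continuous
    fun_prop
  have hh0 : h 0 = 0 := by simp [hh, hg.map_zero]
  have hnonneg (j) : 0 ≤ ∫ x, h (φ j x) := by
    have hz (x) : gradR (0 : EuclideanSpace ℝ (Fin d) → EuclideanSpace ℝ (Fin m)) x = 0 := by
      simp [gradR_eq_jacobianL]
    simpa [hz, hh] using hg.integral_split_nonneg (u := 0) contDiff_const HasCompactSupport.zero
      (φ j).contDiff (φ j).hasCompactSupport a L
  obtain ⟨B, hB⟩ := (isCompact_Icc (a := (0 : ℝ)) (b := 1)).exists_bound_of_continuousOn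
    hhc.continuousOn
  have hlim : Tendsto (fun j => ∫ x, h (φ j x)) atTop
      (𝓝 (∫ x, (Metric.ball (0 : EuclideanSpace ℝ (Fin d)) 1).indicator (fun _ => h 1) x)) := by
    refine tendsto_integral_of_dominated_convergence
      ((Metric.ball (0 : EuclideanSpace ℝ (Fin d)) 1).indicator fun _ => B)
      (fun j => (hhc.comp (φ j).continuous).aestronglyMeasurable) ?_
      (fun j => .of_forall fun x => ?_) (.of_forall fun x => ?_)
    · exact (integrable_indicator_iff measurableSet_ball).2
        (integrableOn_const measure_ball_lt_top.ne)
    · by_cases hx : x ∈ Metric.ball (0 : EuclideanSpace ℝ (Fin d)) 1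
      · rw [Set.indicator_of_mem hx]
        exact hB _ ⟨(φ j).nonneg, (φ j).le_one⟩
      · rw [Set.indicator_of_notMem hx, (φ j).zero_of_le_dist (by simpa using hx), hh0, norm_zero]
    · by_cases hx : x ∈ Metric.ball (0 : EuclideanSpace ℝ (Fin d)) 1
      · rw [Set.indicator_of_mem hx]
        refine tendsto_const_nhds.congr' ?_
        have hx' : ‖x‖ < 1 := by simpa using hx
        have ht : Tendsto (fun j : ℕ => 1 - 1 / ((j : ℝ) + 2)) atTop (𝓝 1) := by
          have := ((tendsto_one_div_add_atTop_nhds_zero_nat (𝕜 := ℝ)).comp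
            (tendsto_add_atTop_nat 1)).const_sub 1
          simp only [sub_zero] at this
          refine this.congr fun j => ?_
          simp only [Function.comp_apply]
          push_cast
          ring
        filter_upwards [ht.eventually (lt_mem_nhds hx')] with j hj
        rw [(φ j).one_of_mem_closedBall (by simpa [φ] using hj.le)]
      · rw [Set.indicator_of_notMem hx]
        refine tendsto_const_nhds.congr fun j => ?_
        rw [(φ j).zero_of_le_dist (by simpa using hx), hh0]
  have key := ge_of_tendsto' hlim hnonneg
  rw [integral_indicator measurableSet_ball, setIntegral_const, smul_eq_mul] at key
  have hpos : 0 < volume.real (Metric.ball (0 : EuclideanSpace ℝ (Fin d)) 1) :=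
    ENNReal.toReal_pos (Metric.measure_ball_pos volume _ one_pos).ne' measure_ball_lt_top.ne
  simpa [hh] using nonneg_of_mul_nonneg_right key hpos

end QuasiconvexAtZero

section Staircase

variable {m d : ℕ} {a₁ a₂ : EuclideanSpace ℝ (Fin m)} {L₁ L₂ : EuclideanSpace ℝ (Fin d) →L[ℝ] ℝ}
  {l₁ l₂ : MatR m d →L[ℝ] ℝ}

/-- A smooth cutoff to the open quadrant `0 < l₁`, `l₂ < 0`. -/
def quadrantCutoff (l₁ l₂ : MatR m d →L[ℝ] ℝ) (ξ : MatR m d) : ℝ :=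
  smoothTransition (2 * l₁ ξ) * smoothTransition (-(2 * l₂ ξ))

lemma contDiff_quadrantCutoff : ContDiff ℝ (⊤ : ℕ∞) (quadrantCutoff l₁ l₂) :=
  (smoothTransition.contDiff.comp (contDiff_const.mul l₁.contDiff)).mul
    (smoothTransition.contDiff.comp (contDiff_const.mul l₂.contDiff).neg)

lemma quadrantCutoff_eq_zero {ξ : MatR m d} (h : l₁ ξ ≤ 0 ∨ 0 ≤ l₂ ξ) :
    quadrantCutoff l₁ l₂ ξ = 0 := by
  rcases h with h | h
  · simp [quadrantCutoff, smoothTransition.zero_of_nonpos (x := 2 * l₁ ξ) (by linarith)]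
  · simp [quadrantCutoff, smoothTransition.zero_of_nonpos (x := -(2 * l₂ ξ)) (by linarith)]

lemma quadrantCutoff_eq_one {ξ : MatR m d} (h₁ : 1 / 2 ≤ l₁ ξ) (h₂ : l₂ ξ ≤ -(1 / 2)) :
    quadrantCutoff l₁ l₂ ξ = 1 := by
  rw [quadrantCutoff, smoothTransition.one_of_one_le (by linarith),
    smoothTransition.one_of_one_le (by linarith), one_mul]

/-- One turn of the staircase laminate: mass at `s (R₁ - R₂ / 2)` is moved to the diagonal
`ℝ (R₁ + R₂)`, except for a quarter of it which ends at `4 s (R₁ - R₂ / 2)`. -/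
lemma QuasiconvexAtZero.exists_staircase_step {f : MatR m d → ℝ} (hf : QuasiconvexAtZero f)
    (h₁₁ : l₁ (rankOne a₁ L₁) = 1) (h₁₂ : l₁ (rankOne a₂ L₂) = 0)
    (h₂₁ : l₂ (rankOne a₁ L₁) = 0) (h₂₂ : l₂ (rankOne a₂ L₂) = 1)
    {c : ℝ} (hfc : ∀ t : ℝ, f (t • (rankOne a₁ L₁ + rankOne a₂ L₂)) = -(|t| * c))
    {s : ℝ} (hs : 1 ≤ s) :
    ∃ g : MatR m d → ℝ, QuasiconvexAtZero g ∧ (∀ ξ, l₁ ξ ≤ 0 ∨ 0 ≤ l₂ ξ → g ξ = f ξ) ∧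
      g (s • (rankOne a₁ L₁ - (1 / 2 : ℝ) • rankOne a₂ L₂)) =
        f ((4 * s) • (rankOne a₁ L₁ - (1 / 2 : ℝ) • rankOne a₂ L₂)) / 4 - s * c := by
  set R₁ := rankOne a₁ L₁ with hR₁
  set R₂ := rankOne a₂ L₂ with hR₂
  set χ := quadrantCutoff l₁ l₂ with hχ
  have hχ0 : χ 0 = 0 := quadrantCutoff_eq_zero (by simp)
  set f₁ : MatR m d → ℝ := fun ξ =>
    (f (ξ + (3 * s * χ ξ) • R₁) + f (ξ - (3 * s * χ ξ) • R₁)) / 2 with hf₁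
  have hqf₁ : QuasiconvexAtZero f₁ :=
    hf.split (contDiff_const.mul contDiff_quadrantCutoff) (by simp [← hχ, hχ0]) a₁ L₁
  have hqf₂ := hqf₁.split (Φ := fun ξ => 3 / 2 * s * χ ξ)
    (contDiff_const.mul contDiff_quadrantCutoff) (by simp [hχ0]) a₂ L₂
  have hf₁D (ξ) (hξ : l₁ ξ ≤ 0 ∨ 0 ≤ l₂ ξ) : f₁ ξ = f ξ := by
    simp [hf₁, hχ, quadrantCutoff_eq_zero hξ]
  refine ⟨_, hqf₂, fun ξ hξ => ?_, ?_⟩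
  · simp [hχ, quadrantCutoff_eq_zero hξ, hf₁D ξ hξ]
  · have e₁ : χ (s • (R₁ - (1 / 2 : ℝ) • R₂)) = 1 := by
      apply quadrantCutoff_eq_one <;> simp [h₁₁, h₁₂, h₂₁, h₂₂] <;> linarith
    have e₂ : χ (s • R₁ - (2 * s) • R₂) = 1 := by
      apply quadrantCutoff_eq_one <;> simp [h₁₁, h₁₂, h₂₁, h₂₂] <;> linarith
    have p₁ : s • (R₁ - (1 / 2 : ℝ) • R₂) + (3 / 2 * s) • R₂ = s • (R₁ + R₂) := by module
    have p₂ : s • (R₁ - (1 / 2 : ℝ) • R₂) - (3 / 2 * s) • R₂ = s • R₁ - (2 * s) • R₂ := by module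
    have p₃ : s • R₁ - (2 * s) • R₂ + (3 * s) • R₁ = (4 * s) • (R₁ - (1 / 2 : ℝ) • R₂) := by module
    have p₄ : s • R₁ - (2 * s) • R₂ - (3 * s) • R₁ = (-(2 * s)) • (R₁ + R₂) := by module
    have v₁ : f₁ (s • (R₁ + R₂)) = -(s * c) := by
      rw [hf₁D _ (.inr (by simp [h₂₁, h₂₂]; linarith)), hfc, abs_of_nonneg (by linarith)]
    have v₂ : f₁ (s • R₁ - (2 * s) • R₂) =
        (f ((4 * s) • (R₁ - (1 / 2 : ℝ) • R₂)) - 2 * s * c) / 2 := by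
      simp only [hf₁, e₂, mul_one, p₃, p₄, hfc, abs_neg]
      rw [abs_of_nonneg (by linarith)]
      ring
    simp only [e₁, mul_one, ← hR₂, p₁, p₂, v₁, v₂]
    ring

/-- Iterating the staircase laminate `n` times. -/
lemma QuasiconvexAtZero.exists_staircase
    (h₁₁ : l₁ (rankOne a₁ L₁) = 1) (h₁₂ : l₁ (rankOne a₂ L₂) = 0)
    (h₂₁ : l₂ (rankOne a₁ L₁) = 0) (h₂₂ : l₂ (rankOne a₂ L₂) = 1) {c : ℝ} (n : ℕ)
    {f : MatR m d → ℝ} (hf : QuasiconvexAtZero f)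
    (hfc : ∀ t : ℝ, f (t • (rankOne a₁ L₁ + rankOne a₂ L₂)) = -(|t| * c)) :
    ∃ g : MatR m d → ℝ, QuasiconvexAtZero g ∧ (∀ ξ, l₁ ξ ≤ 0 ∨ 0 ≤ l₂ ξ → g ξ = f ξ) ∧
      g (rankOne a₁ L₁ - (1 / 2 : ℝ) • rankOne a₂ L₂) =
        f ((4 : ℝ) ^ n • (rankOne a₁ L₁ - (1 / 2 : ℝ) • rankOne a₂ L₂)) / 4 ^ n - n * c := by
  induction n generalizing f with
  | zero => exact ⟨f, hf, fun _ _ => rfl, by simp⟩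
  | succ n ih =>
    obtain ⟨f', hf', hD, hval⟩ := hf.exists_staircase_step h₁₁ h₁₂ h₂₁ h₂₂ hfc
      (one_le_pow₀ (by norm_num : (1 : ℝ) ≤ 4) : (1 : ℝ) ≤ 4 ^ n)
    obtain ⟨g, hg, hgD, hgval⟩ := ih hf' fun t => by
      rw [hD _ ?_, hfc]
      simp only [map_smul, map_add, h₁₁, h₁₂, h₂₁, h₂₂, smul_eq_mul, add_zero, zero_add, mul_one]
      exact le_total t 0
    refine ⟨g, hg, fun ξ hξ => (hgD ξ hξ).trans (hD ξ hξ), ?_⟩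
    rw [hgval, hval, ← pow_succ']
    push_cast
    field_simp
    ring

/-- A positively homogeneous integrand that is quasiconvex at `0` and even on the line through the
sum of two independent rank-one matrices is nonnegative on that line. -/
lemma QuasiconvexAtZero.nonpos_of_homogeneous {f : MatR m d → ℝ} (hf : QuasiconvexAtZero f)
    (hhom : ∀ (t : ℝ) (ξ), 0 ≤ t → f (t • ξ) = t * f ξ)
    (h₁₁ : l₁ (rankOne a₁ L₁) = 1) (h₁₂ : l₁ (rankOne a₂ L₂) = 0)
    (h₂₁ : l₂ (rankOne a₁ L₁) = 0) (h₂₂ : l₂ (rankOne a₂ L₂) = 1) {c : ℝ}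
    (hfc : ∀ t : ℝ, f (t • (rankOne a₁ L₁ + rankOne a₂ L₂)) = -(|t| * c)) : c ≤ 0 := by
  by_contra! hc
  set R₁ := rankOne a₁ L₁ with hR₁
  set R₂ := rankOne a₂ L₂ with hR₂
  obtain ⟨n, hn⟩ := exists_nat_gt
    ((f (R₁ + (1 / 2 : ℝ) • R₂) + f (R₁ - (1 / 2 : ℝ) • R₂) + 2 * f (-R₁)) / c)
  rw [div_lt_iff₀ hc] at hn
  obtain ⟨g, hg, hgD, hgval⟩ := QuasiconvexAtZero.exists_staircase h₁₁ h₁₂ h₂₁ h₂₂ n hf hfc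
  rw [hhom _ _ (by positivity), mul_div_cancel_left₀ _ (by positivity)] at hgval
  have hspl := hg.split (Φ := fun ξ => 1 / 2 * smoothTransition (l₁ ξ))
    (contDiff_const.mul (smoothTransition.contDiff.comp l₁.contDiff)) (by simp) a₂ L₂
  have key := hspl.add_neg_rankOne_nonneg a₁ L₁
  have e₁ : smoothTransition (l₁ R₁) = 1 := smoothTransition.one_of_one_le h₁₁.ge
  have e₂ : smoothTransition (l₁ (-R₁)) = 0 :=
    smoothTransition.zero_of_nonpos (by rw [map_neg, h₁₁]; norm_num)
  have v₁ : g (-R₁) = f (-R₁) := hgD _ (.inl (by rw [map_neg, h₁₁]; norm_num))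
  have v₂ : g (R₁ + (1 / 2 : ℝ) • R₂) = f (R₁ + (1 / 2 : ℝ) • R₂) :=
    hgD _ (.inr (by simp [h₂₁, h₂₂]))
  simp only [← hR₁, ← hR₂, e₁, e₂, mul_one, mul_zero, zero_smul, add_zero, sub_zero, v₁, v₂] at key
  linarith

end Staircase

section RankTwo

variable {m d : ℕ}

/-- A matrix of rank at most two is a sum of two rank-one matrices. -/
lemma exists_eq_rankOne_add_rankOne (v : MatR m d) (hv : (matOfR v).rank ≤ 2) :
    ∃ (a₁ a₂ : EuclideanSpace ℝ (Fin m)) (L₁ L₂ : EuclideanSpace ℝ (Fin d) →L[ℝ] ℝ),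
      v = rankOne a₁ L₁ + rankOne a₂ L₂ := by
  rw [Matrix.rank_eq_finrank_span_cols] at hv
  set S := Submodule.span ℝ (Set.range (matOfR v).col) with hS
  obtain ⟨ι, hι⟩ : ∃ ι : S →ₗ[ℝ] (Fin 2 → ℝ), Function.Injective ι :=
    finrank_le_iff_exists_linearMap.1 (by simpa using hv)
  obtain ⟨ρ, hρ⟩ := LinearMap.exists_leftInverse_of_injective ι (LinearMap.ker_eq_bot.2 hι)
  let w (j : Fin d) : Fin 2 → ℝ := ι ⟨(matOfR v).col j, Submodule.subset_span ⟨j, rfl⟩⟩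
  let A (i : Fin 2) : EuclideanSpace ℝ (Fin m) := WithLp.toLp 2 (ρ (Pi.single i 1)).1
  let L (i : Fin 2) : EuclideanSpace ℝ (Fin d) →L[ℝ] ℝ :=
    ∑ j, w j i • EuclideanSpace.proj j
  refine ⟨A 0, A 1, L 0, L 1, ?_⟩
  ext ⟨i, j⟩
  have hL (k : Fin 2) : L k (EuclideanSpace.single j 1) = w j k := by
    simp [L]
  have hw : ρ (w j) = ⟨(matOfR v).col j, Submodule.subset_span ⟨j, rfl⟩⟩ :=
    LinearMap.congr_fun hρ _
  have hsum : w j = w j 0 • Pi.single 0 1 + w j 1 • Pi.single 1 1 := by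
    ext k
    fin_cases k <;> simp
  have hval : v (i, j) = (ρ (w j)).1 i := by
    rw [hw]
    rfl
  rw [hval, hsum, map_add, map_smul, map_smul, PiLp.add_apply, rankOne_apply, rankOne_apply, hL, hL]
  rfl

/-- Either one of two vectors is a multiple of the other or they have a dual pair. -/
lemma exists_dual_pair_or_dependent {V : Type*} [NormedAddCommGroup V] [NormedSpace ℝ V]
    [FiniteDimensional ℝ V] (v w : V) :
    (∃ t : ℝ, v = t • w) ∨ (∃ t : ℝ, w = t • v) ∨
      ∃ l₁ l₂ : V →L[ℝ] ℝ, l₁ v = 1 ∧ l₁ w = 0 ∧ l₂ v = 0 ∧ l₂ w = 1 := by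
  have dual {v w : V} (h : ¬ ∃ t : ℝ, v = t • w) : ∃ l : V →L[ℝ] ℝ, l v = 1 ∧ l w = 0 := by
    obtain ⟨l, hlv, hlw⟩ := Submodule.exists_le_ker_of_notMem
      (p := Submodule.span ℝ {w}) (v := v) fun hv => by
        obtain ⟨t, ht⟩ := Submodule.mem_span_singleton.1 hv
        exact h ⟨t, ht.symm⟩
    have hw : l w = 0 := hlw (Submodule.mem_span_singleton_self w)
    exact ⟨(l v)⁻¹ • LinearMap.toContinuousLinearMap l, by simp [hlv], by simp [hw]⟩
  by_cases hv : ∃ t : ℝ, v = t • w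
  · exact .inl hv
  by_cases hw : ∃ t : ℝ, w = t • v
  · exact .inr (.inl hw)
  obtain ⟨l₁, h₁, h₂⟩ := dual hv
  obtain ⟨l₂, h₃, h₄⟩ := dual hw
  exact .inr (.inr ⟨l₁, l₂, h₁, h₂, h₄, h₃⟩)

end RankTwo

/-- If the `L¹` estimate holds with constant `C`, then `C ‖T ξ‖ - ‖ξ‖` is quasiconvex at `0`. -/
lemma quasiconvexAtZero_of_estimate {m d k : ℕ} (T : MatR m d →ₗ[ℝ] EuclideanSpace ℝ (Fin k))
    {C : ℝ} (h : ∀ u : EuclideanSpace ℝ (Fin d) → EuclideanSpace ℝ (Fin m),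
      ContDiff ℝ (⊤ : ℕ∞) u → HasCompactSupport u →
        ∫ x, ‖gradR u x‖ ≤ C * ∫ x, ‖T (gradR u x)‖) :
    QuasiconvexAtZero fun ξ => C * ‖T ξ‖ - ‖ξ‖ where
  continuous := by
    have := T.continuous_of_finiteDimensional
    fun_prop
  map_zero := by simp
  integral_nonneg u hu hcu := by
    have hc := (contDiff_gradR hu).continuous
    have hT := T.continuous_of_finiteDimensional
    have hs := hasCompactSupport_gradR hcu
    have h₁ : Integrable fun x => ‖gradR u x‖ := (hc.integrable_of_hasCompactSupport hs).norm
    have h₂ : Integrable fun x => ‖T (gradR u x)‖ :=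
      ((hT.comp hc).integrable_of_hasCompactSupport (hs.comp_left (map_zero T))).norm
    rw [integral_sub (h₂.const_mul C) h₁, integral_const_mul, sub_nonneg]
    exact h u hu hcu

end OrnsteinNonInequality

/-- Ornstein's non-inequality: if `T : M_{m,d}(ℝ) → ℝ^k` is linear and its kernel
contains a nonzero matrix of rank at most `2`, then there is no constant `C` with
`∫ ‖∇u‖ ≤ C ∫ |T(∇u)|` for all `u ∈ C_c^∞(ℝ^d, ℝ^m)`: for every `C > 0` some
`u ∈ C_c^∞(ℝ^d, ℝ^m)` satisfies `‖∇u‖_{L¹} > C ‖T(∇u)‖_{L¹}`. -/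
theorem statement_18 (d m k : ℕ) (hd : 2 ≤ d) (hm : 2 ≤ m)
    (T : MatR m d →ₗ[ℝ] EuclideanSpace ℝ (Fin k))
    (hker : ∃ v : MatR m d, T v = 0 ∧ v ≠ 0 ∧ (matOfR v).rank ≤ 2) :
    ∀ C : ℝ, 0 < C → ∃ u : EuclideanSpace ℝ (Fin d) → EuclideanSpace ℝ (Fin m),
      ContDiff ℝ (⊤ : ℕ∞) u ∧ HasCompactSupport u ∧
      C * ∫ x, ‖T (gradR u x)‖ < ∫ x, ‖gradR u x‖ := by
  intro C _
  obtain ⟨v, hTv, hv, hrank⟩ := hker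
  by_contra! hneg
  set f : MatR m d → ℝ := fun ξ => C * ‖T ξ‖ - ‖ξ‖ with hf
  have hqf : QuasiconvexAtZero f := quasiconvexAtZero_of_estimate T hneg
  have hpos : 0 < ‖v‖ := norm_pos_iff.2 hv
  have hrankOne (a L) : v ≠ rankOne a L := by
    rintro rfl
    have := hqf.add_neg_rankOne_nonneg a L
    simp only [hf, map_neg, hTv, norm_neg, norm_zero] at this
    linarith
  obtain ⟨a₁, a₂, L₁, L₂, hsum⟩ := exists_eq_rankOne_add_rankOne v hrank
  rcases exists_dual_pair_or_dependent (rankOne a₁ L₁) (rankOne a₂ L₂) with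
    ⟨t, ht⟩ | ⟨t, ht⟩ | ⟨l₁, l₂, h₁₁, h₁₂, h₂₁, h₂₂⟩
  · refine hrankOne a₂ (t • L₂ + L₂) ?_
    rw [hsum, ht, map_add, map_smul]
  · refine hrankOne a₁ (L₁ + t • L₁) ?_
    rw [hsum, ht, map_add, map_smul]
  · refine hpos.not_ge (hqf.nonpos_of_homogeneous (fun t ξ ht => ?_) h₁₁ h₁₂ h₂₁ h₂₂ fun t => ?_)
    · simp only [hf, map_smul, norm_smul, Real.norm_of_nonneg ht]
      ring
    · simp [hf, ← hsum, hTv, norm_smul]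
end
end

section
/- For n ≥ 1 define functions f_n, g_n : [0,1] → ℝ by f_n = Σ_{i=1}^n 2^{i−1}(2·1_{[0,2^{−i}]} − 1_{[0,2^{−i+1}]}) and g_n = Σ_{i=1}^n (−1)^{i−1} 2^{i−1}(2·1_{[0,2^{−i}]} − 1_{[0,2^{−i+1}]}), where 1_I denotes the indicator function of the interval I. Then ∫₀¹ |f_n(x)| dx ≤ 2 while ∫₀¹ |g_n(x)| dx ≥ (2n−1)/3; in particular the L¹ norms of f_n stay bounded while those of its ±1-transform g_n grow linearly in n. -/
open MeasureTheory

noncomputable section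

/-- The martingale difference `d f_i = 2^{i−1} (2·1_{[0, 2^{−i}]} − 1_{[0, 2^{−i+1}]})`. -/
def dF (i : ℕ) : ℝ → ℝ := fun x =>
  (2 : ℝ) ^ (i - 1) *
    (2 * Set.indicator (Set.Icc (0 : ℝ) (((2 : ℝ) ^ i)⁻¹)) (fun _ => (1 : ℝ)) x -
      Set.indicator (Set.Icc (0 : ℝ) (((2 : ℝ) ^ (i - 1))⁻¹)) (fun _ => (1 : ℝ)) x)

/-- `f_n = Σ_{i=1}^n d f_i`. -/
def fseq (n : ℕ) : ℝ → ℝ := fun x => ∑ i ∈ Finset.Icc 1 n, dF i x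

/-- The ±1-transform `g_n = Σ_{i=1}^n (−1)^{i−1} d f_i`. -/
def gseq (n : ℕ) : ℝ → ℝ := fun x => ∑ i ∈ Finset.Icc 1 n, (-1 : ℝ) ^ (i - 1) * dF i x

/-- The indicator function of `[0, 2^{-n}]`. -/
def dyadicInd (n : ℕ) : ℝ → ℝ :=
  Set.indicator (Set.Icc (0 : ℝ) (((2 : ℝ) ^ n)⁻¹)) (fun _ => (1 : ℝ))

lemma inv_two_pow_le_one (n : ℕ) : ((2 : ℝ) ^ n)⁻¹ ≤ 1 :=
  inv_le_one_of_one_le₀ (one_le_pow₀ (by norm_num))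

lemma inv_two_pow_succ_le (n : ℕ) : ((2 : ℝ) ^ (n + 1))⁻¹ ≤ ((2 : ℝ) ^ n)⁻¹ := by
  have : (0 : ℝ) < 2 ^ n := by positivity
  gcongr
  · norm_num
  · omega

lemma dyadicInd_nonneg (n : ℕ) (x : ℝ) : 0 ≤ dyadicInd n x :=
  Set.indicator_nonneg (fun _ _ => zero_le_one) x

lemma integrable_dyadicInd (n : ℕ) :
    Integrable (dyadicInd n) (volume.restrict (Set.Icc (0 : ℝ) 1)) :=
  (integrable_const (1 : ℝ)).indicator measurableSet_Icc

lemma integral_dyadicInd (n : ℕ) :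
    ∫ x in Set.Icc (0 : ℝ) 1, dyadicInd n x = ((2 : ℝ) ^ n)⁻¹ := by
  have hs : Set.Icc (0 : ℝ) (((2 : ℝ) ^ n)⁻¹) ⊆ Set.Icc (0 : ℝ) 1 :=
    Set.Icc_subset_Icc_right (inv_two_pow_le_one n)
  have hp : (0 : ℝ) ≤ ((2 : ℝ) ^ n)⁻¹ := by positivity
  unfold dyadicInd
  rw [setIntegral_indicator measurableSet_Icc, Set.inter_eq_self_of_subset_right hs]
  simp [hp]

lemma dF_succ (n : ℕ) (x : ℝ) :
    dF (n + 1) x = 2 ^ (n + 1) * dyadicInd (n + 1) x - 2 ^ n * dyadicInd n x := by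
  simp only [dF, dyadicInd, Nat.add_sub_cancel]
  ring

lemma fseq_eq (n : ℕ) (x : ℝ) : fseq n x = 2 ^ n * dyadicInd n x - dyadicInd 0 x := by
  induction n with
  | zero => simp [fseq]
  | succ n ih =>
    have h : fseq (n + 1) x = fseq n x + dF (n + 1) x := by
      simp [fseq, Finset.sum_Icc_succ_top]
    rw [h, ih, dF_succ]
    ring

lemma gseq_succ (n : ℕ) (x : ℝ) : gseq (n + 1) x = gseq n x +
    (-1) ^ n * (2 ^ (n + 1) * dyadicInd (n + 1) x - 2 ^ n * dyadicInd n x) := by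
  rw [← dF_succ]
  simp [gseq, Finset.sum_Icc_succ_top]

lemma gseq_of_mem (n : ℕ) {x : ℝ} (hx : x ∈ Set.Icc (0 : ℝ) (((2 : ℝ) ^ n)⁻¹)) :
    gseq n x = (1 - (-2) ^ n) / 3 := by
  induction n with
  | zero => simp [gseq]
  | succ n ih =>
    have hx' : x ∈ Set.Icc (0 : ℝ) (((2 : ℝ) ^ n)⁻¹) :=
      ⟨hx.1, hx.2.trans (inv_two_pow_succ_le n)⟩
    have h : (-2 : ℝ) ^ n = (-1) ^ n * 2 ^ n := by rw [← mul_pow]; norm_num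
    rw [gseq_succ, ih hx', dyadicInd, dyadicInd, Set.indicator_of_mem hx,
      Set.indicator_of_mem hx', pow_succ (-2 : ℝ), h]
    ring

lemma abs_gseq_succ (n : ℕ) (x : ℝ) : |gseq (n + 1) x| = |gseq n x| +
    ((|(1 - (-2) ^ (n + 1)) / 3| - |(1 - 4 * (-2) ^ n) / 3|) * dyadicInd (n + 1) x +
      (|(1 - 4 * (-2) ^ n) / 3| - |(1 - (-2) ^ n) / 3|) * dyadicInd n x) := by
  by_cases hx : x ∈ Set.Icc (0 : ℝ) (((2 : ℝ) ^ n)⁻¹)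
  · have h0 : dyadicInd n x = 1 := Set.indicator_of_mem hx _
    by_cases hx' : x ∈ Set.Icc (0 : ℝ) (((2 : ℝ) ^ (n + 1))⁻¹)
    · have h1 : dyadicInd (n + 1) x = 1 := Set.indicator_of_mem hx' _
      rw [h0, h1, gseq_of_mem n hx, gseq_of_mem (n + 1) hx']
      ring
    · have h1 : dyadicInd (n + 1) x = 0 := Set.indicator_of_notMem hx' _
      have h : (-2 : ℝ) ^ n = (-1) ^ n * 2 ^ n := by rw [← mul_pow]; norm_num
      have h2 : gseq (n + 1) x = (1 - 4 * (-2) ^ n) / 3 := by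
        rw [gseq_succ, h0, h1, gseq_of_mem n hx, h]
        ring
      rw [h0, h1, h2, gseq_of_mem n hx]
      ring
  · have h0 : dyadicInd n x = 0 := Set.indicator_of_notMem hx _
    have h1 : dyadicInd (n + 1) x = 0 := Set.indicator_of_notMem
      (fun h => hx ⟨h.1, h.2.trans (inv_two_pow_succ_le n)⟩) _
    rw [gseq_succ, h0, h1]
    simp

lemma integrable_gseq (n : ℕ) :
    Integrable (gseq n) (volume.restrict (Set.Icc (0 : ℝ) 1)) := by
  induction n with
  | zero => exact integrable_zero _ _ _
  | succ n ih =>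
    rw [funext (gseq_succ n)]
    exact ih.add ((((integrable_dyadicInd (n + 1)).const_mul _).sub
      ((integrable_dyadicInd n).const_mul _)).const_mul _)

lemma integral_abs_gseq_succ (n : ℕ) : ∫ x in Set.Icc (0 : ℝ) 1, |gseq (n + 1) x| =
    (∫ x in Set.Icc (0 : ℝ) 1, |gseq n x|) +
    ((|(1 - (-2) ^ (n + 1)) / 3| - |(1 - 4 * (-2) ^ n) / 3|) * ((2 : ℝ) ^ (n + 1))⁻¹ +
      (|(1 - 4 * (-2) ^ n) / 3| - |(1 - (-2) ^ n) / 3|) * ((2 : ℝ) ^ n)⁻¹) := by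
  have h1 := (integrable_dyadicInd (n + 1)).const_mul
    (|((1 : ℝ) - (-2) ^ (n + 1)) / 3| - |(1 - 4 * (-2) ^ n) / 3|)
  have h0 := (integrable_dyadicInd n).const_mul
    (|((1 : ℝ) - 4 * (-2) ^ n) / 3| - |(1 - (-2) ^ n) / 3|)
  simp_rw [abs_gseq_succ]
  refine (integral_add (integrable_gseq n).abs (h1.add h0)).trans ?_
  simp only [Pi.add_apply]
  rw [integral_add h1 h0, integral_const_mul, integral_const_mul, integral_dyadicInd, integral_dyadicInd]

lemma le_integral_abs_gseq (n : ℕ) :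
    |(1 - (-2) ^ n) / 3| * ((2 : ℝ) ^ n)⁻¹ + (2 * n - (1 - ((2 : ℝ) ^ n)⁻¹)) / 3 ≤
      ∫ x in Set.Icc (0 : ℝ) 1, |gseq n x| := by
  induction n with
  | zero => simp [gseq]
  | succ n ih =>
    have hd : (4 * 2 ^ n - 1) / 3 ≤ |((1 : ℝ) - 4 * (-2) ^ n) / 3| := by
      have h := abs_sub_abs_le_abs_sub (4 * (-2 : ℝ) ^ n) 1
      rw [abs_mul, abs_pow, abs_sub_comm] at h
      rw [abs_div]
      norm_num at h ⊢
      linarith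
    have hp : (0 : ℝ) < 2 ^ n := by positivity
    have hs : ((2 : ℝ) ^ (n + 1))⁻¹ = ((2 : ℝ) ^ n)⁻¹ / 2 := by
      rw [pow_succ, mul_inv]
      ring
    have hm := mul_le_mul_of_nonneg_right hd (inv_pos.mpr hp).le
    have he : (4 * 2 ^ n - 1) / 3 * ((2 : ℝ) ^ n)⁻¹ = (4 - ((2 : ℝ) ^ n)⁻¹) / 3 := by
      field_simp
    rw [integral_abs_gseq_succ, hs]
    push_cast
    linarith

lemma integral_abs_fseq_le (n : ℕ) : ∫ x in Set.Icc (0 : ℝ) 1, |fseq n x| ≤ 2 := by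
  have hn := (integrable_dyadicInd n).const_mul ((2 : ℝ) ^ n)
  have h0 := integrable_dyadicInd 0
  calc ∫ x in Set.Icc (0 : ℝ) 1, |fseq n x|
      ≤ ∫ x in Set.Icc (0 : ℝ) 1, (2 ^ n * dyadicInd n x + dyadicInd 0 x) := by
        refine integral_mono ?_ (hn.add h0) fun x => ?_
        · rw [funext fun x => congrArg abs (fseq_eq n x)]
          exact (hn.sub h0).abs
        · have h1 : 0 ≤ 2 ^ n * dyadicInd n x := mul_nonneg (by positivity) (dyadicInd_nonneg n x)
          have h2 := dyadicInd_nonneg 0 x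
          simp only [fseq_eq]
          exact abs_le.mpr ⟨by linarith, by linarith⟩
    _ = 2 := by
        rw [integral_add hn h0, integral_const_mul, integral_dyadicInd, integral_dyadicInd,
          mul_inv_cancel₀ (by positivity)]
        norm_num

/-- The `L¹` norms of the dyadic martingale `f_n` stay bounded by `2`, while those of
its ±1-transform `g_n` grow linearly: `∫₀¹ |g_n| ≥ (2n − 1)/3`. -/
theorem statement_19 (n : ℕ) (hn : 1 ≤ n) :
    (∫ x in Set.Icc (0 : ℝ) 1, |fseq n x|) ≤ 2 ∧
      (2 * (n : ℝ) - 1) / 3 ≤ ∫ x in Set.Icc (0 : ℝ) 1, |gseq n x| := by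
  refine ⟨integral_abs_fseq_le n, le_trans ?_ (le_integral_abs_gseq n)⟩
  have h1 : (0 : ℝ) ≤ |(1 - (-2) ^ n) / 3| * ((2 : ℝ) ^ n)⁻¹ := by positivity
  have h2 : (0 : ℝ) < ((2 : ℝ) ^ n)⁻¹ := by positivity
  linarith
end
end
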